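/- Let n ≥ 1 and p ≥ 1. For all homogeneous matrices X₁, …, X_{2p+1} ∈ osp(1,2n), the matrix 𝒫_{2p+1}(X₁,…,X_{2p+1}) again belongs to osp(1,2n). -/

import Mathlib

open Matrix

/-- Index type for the ℤ₂-graded space ℂ^p ⊕ ℂ^q. -/
abbrev Idx (p q : ℕ) := Sum (Fin p) (Fin q)

/-- Parity of a basis index. -/
def ipar {p q : ℕ} : Idx p q → ZMod 2
  | Sum.inl _ => 0
  | Sum.inr _ => 1

/-- `(-1)^a` for `a : ZMod 2`. -/
noncomputable def sgn (a : ZMod 2) : ℂ := if a = 1 then -1 else 1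

/-- A matrix is homogeneous of parity `ε` iff it maps the graded piece of
parity `a` into the piece of parity `a + ε`; equivalently, its entry `X i j`
vanishes unless `ipar i = ipar j + ε`. -/
def HasParity {p q : ℕ} (X : Matrix (Idx p q) (Idx p q) ℂ) (ε : ZMod 2) : Prop :=
  ∀ i j, ipar i ≠ ipar j + ε → X i j = 0

/-- A vector is homogeneous of parity `ε`. -/
def VHasParity {p q : ℕ} (u : Idx p q → ℂ) (ε : ZMod 2) : Prop :=
  ∀ i, ipar i ≠ ε → u i = 0

/-- The super sign `ε(σ, 𝒳) = (-1)^{K(σ,𝒳)}`, where `K(σ,𝒳)` is the number of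
pairs `(i,j)` with `i < j`, `σ i > σ j` and both `X (σ i)`, `X (σ j)` odd
(here only the parities `px` of the `X`'s matter). -/
noncomputable def superSign {k : ℕ} (σ : Equiv.Perm (Fin k)) (px : Fin k → ZMod 2) : ℂ :=
  (-1 : ℂ) ^ (Finset.univ.filter (fun ij : Fin k × Fin k =>
      ij.1 < ij.2 ∧ σ ij.2 < σ ij.1 ∧ px (σ ij.1) = 1 ∧ px (σ ij.2) = 1)).card

/-- The ordered matrix product `X (σ 0) * X (σ 1) * ⋯ * X (σ (k-1))`. -/
noncomputable def permProd {k p q : ℕ} (σ : Equiv.Perm (Fin k))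
    (X : Fin k → Matrix (Idx p q) (Idx p q) ℂ) : Matrix (Idx p q) (Idx p q) ℂ :=
  (List.ofFn fun i => X (σ i)).prod

/-- The standard supersymmetric super polynomial `𝒫_k`. -/
noncomputable def symPoly {k p q : ℕ} (X : Fin k → Matrix (Idx p q) (Idx p q) ℂ)
    (px : Fin k → ZMod 2) : Matrix (Idx p q) (Idx p q) ℂ :=
  ∑ σ : Equiv.Perm (Fin k), superSign σ px • permProd σ X

/-- The standard skew supersymmetric super polynomial `𝒜_k`. -/
noncomputable def skewPoly {k p q : ℕ} (X : Fin k → Matrix (Idx p q) (Idx p q) ℂ)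
    (px : Fin k → ZMod 2) : Matrix (Idx p q) (Idx p q) ℂ :=
  ∑ σ : Equiv.Perm (Fin k),
    (((Equiv.Perm.sign σ : ℤ) : ℂ) * superSign σ px) • permProd σ X

/-- The supertrace `str X = tr A - tr D` of a matrix in `gl(p,q)`. -/
noncomputable def strace {p q : ℕ} (X : Matrix (Idx p q) (Idx p q) ℂ) : ℂ :=
  ∑ i : Fin p, X (Sum.inl i) (Sum.inl i) - ∑ j : Fin q, X (Sum.inr j) (Sum.inr j)

/-- The super bracket `[A,B] = AB - (-1)^{|A||B|} BA` of homogeneous matrices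
`A`, `B` of parities `a`, `b`. -/
noncomputable def sbr {p q : ℕ} (A : Matrix (Idx p q) (Idx p q) ℂ) (a : ZMod 2)
    (B : Matrix (Idx p q) (Idx p q) ℂ) (b : ZMod 2) : Matrix (Idx p q) (Idx p q) ℂ :=
  A * B - sgn (a * b) • (B * A)

/-- The matrix of the even bilinear form `B` on `ℂ ⊕ ℂ^{2n}`: it is `1` on the
even line, `0` between the even and odd parts, and the standard symplectic form
with matrix `[[0, Iₙ],[-Iₙ, 0]]` on `ℂ^{2n}`. -/
noncomputable def Bmat (n : ℕ) : Matrix (Idx 1 (2*n)) (Idx 1 (2*n)) ℂ :=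
  fun i j => match i, j with
  | Sum.inl _, Sum.inl _ => 1
  | Sum.inl _, Sum.inr _ => 0
  | Sum.inr _, Sum.inl _ => 0
  | Sum.inr a, Sum.inr b =>
      if a.val + n = b.val then 1 else if b.val + n = a.val then -1 else 0

/-- The bilinear form `B(u,v)` on `ℂ ⊕ ℂ^{2n}`. -/
noncomputable def Bform (n : ℕ) (u v : Idx 1 (2*n) → ℂ) : ℂ :=
  ∑ i, ∑ j, u i * Bmat n i j * v j

/-- `X` is a homogeneous element of `osp(1,2n)` of parity `ε`:
`B(Xu,v) + (-1)^{|X||u|} B(u,Xv) = 0` for all homogeneous `u`, `v`. -/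
def ospMem {n : ℕ} (X : Matrix (Idx 1 (2*n)) (Idx 1 (2*n)) ℂ) (ε : ZMod 2) : Prop :=
  HasParity X ε ∧
  ∀ (u v : Idx 1 (2*n) → ℂ) (εu εv : ZMod 2), VHasParity u εu → VHasParity v εv →
    Bform n (X.mulVec u) v + sgn (ε * εu) * Bform n u (X.mulVec v) = 0

theorem sgn_add (a b : ZMod 2) : sgn (a + b) = sgn a * sgn b := by
  have h : ∀ a b : ZMod 2, a + b = 1 ↔ ¬(a = 1 ↔ b = 1) := by decide
  simp only [sgn, h]
  split_ifs <;> first | tauto | norm_num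

theorem hasParity_one {p q : ℕ} : HasParity (1 : Matrix (Idx p q) (Idx p q) ℂ) 0 := by
  intro i j h
  refine Matrix.one_apply_ne ?_
  rintro rfl
  simp at h

theorem HasParity.mul {p q : ℕ} {A B : Matrix (Idx p q) (Idx p q) ℂ} {a b : ZMod 2}
    (hA : HasParity A a) (hB : HasParity B b) : HasParity (A * B) (a + b) := by
  intro i j h
  rw [Matrix.mul_apply]
  refine Finset.sum_eq_zero fun l _ => ?_
  by_cases h₁ : ipar i = ipar l + a
  · rw [hB l j, mul_zero]
    intro h₂
    exact h (by rw [h₁, h₂]; ring)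
  · rw [hA i l h₁, zero_mul]

theorem HasParity.mulVec {p q : ℕ} {A : Matrix (Idx p q) (Idx p q) ℂ} {u : Idx p q → ℂ}
    {a b : ZMod 2} (hA : HasParity A a) (hu : VHasParity u b) :
    VHasParity (A.mulVec u) (a + b) := by
  intro i h
  rw [Matrix.mulVec, dotProduct]
  refine Finset.sum_eq_zero fun l _ => ?_
  by_cases h₁ : ipar i = ipar l + a
  · rw [hu l, mul_zero]
    intro h₂
    exact h (by rw [h₁, h₂]; ring)
  · rw [hA i l h₁, zero_mul]

theorem HasParity.prod_ofFn {k p q : ℕ} {X : Fin k → Matrix (Idx p q) (Idx p q) ℂ}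
    {px : Fin k → ZMod 2} (h : ∀ i, HasParity (X i) (px i)) :
    HasParity (List.ofFn X).prod (∑ i, px i) := by
  induction k with
  | zero => simpa using hasParity_one
  | succ k ih =>
    rw [List.ofFn_succ, List.prod_cons, Fin.sum_univ_succ]
    exact (h 0).mul (ih fun i => h i.succ)

theorem HasParity.symPoly {k p q : ℕ} {X : Fin k → Matrix (Idx p q) (Idx p q) ℂ}
    {px : Fin k → ZMod 2} (h : ∀ i, HasParity (X i) (px i)) :
    HasParity (symPoly X px) (∑ i, px i) := by
  intro i j hij
  rw [_root_.symPoly, Matrix.sum_apply]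
  refine Finset.sum_eq_zero fun σ _ => ?_
  have hσ : HasParity (permProd σ X) (∑ i, px (σ i)) := .prod_ofFn fun i => h (σ i)
  rw [Equiv.sum_comp σ px] at hσ
  rw [Matrix.smul_apply, hσ i j hij, smul_zero]

/-- The sign `(-1)^{∑_{i<j} |X_i||X_j|}` of reversing a product of homogeneous factors. -/
noncomputable def revSign {k : ℕ} (px : Fin k → ZMod 2) : ℂ :=
  ∏ i, ∏ j, if i < j then sgn (px i * px j) else 1

theorem sgn_sum {k : ℕ} (a : Fin k → ZMod 2) : sgn (∑ i, a i) = ∏ i, sgn (a i) := by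
  induction k with
  | zero => simp [sgn]
  | succ k ih => rw [Fin.sum_univ_succ, Fin.prod_univ_succ, sgn_add, ih]

theorem revSign_succ {k : ℕ} (px : Fin (k + 1) → ZMod 2) :
    revSign px = sgn (px 0 * ∑ i : Fin k, px i.succ) * revSign fun i => px i.succ := by
  simp [revSign, Fin.prod_univ_succ, Finset.mul_sum, sgn_sum]

theorem superSign_eq_prod {k : ℕ} (σ : Equiv.Perm (Fin k)) (px : Fin k → ZMod 2) :
    superSign σ px =
      ∏ i, ∏ j, if i < j ∧ σ j < σ i then sgn (px (σ i) * px (σ j)) else 1 := by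
  have h : ∀ a b : ZMod 2, a * b = 1 ↔ a = 1 ∧ b = 1 := by decide
  rw [superSign, ← Finset.prod_const, Finset.prod_filter, Fintype.prod_prod_type]
  refine Finset.prod_congr rfl fun i _ => Finset.prod_congr rfl fun j _ => ?_
  simp only [sgn, h]
  split_ifs <;> tauto

theorem superSign_mul_self {k : ℕ} (σ : Equiv.Perm (Fin k)) (px : Fin k → ZMod 2) :
    superSign σ px * superSign σ px = 1 := by
  rw [superSign, ← mul_pow]
  simp

theorem superSign_mul_superSign_rev {k : ℕ} (σ : Equiv.Perm (Fin k)) (px : Fin k → ZMod 2) :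
    superSign σ px * superSign (σ * Fin.revPerm) px = revSign fun i => px (σ i) := by
  have hrev : superSign (σ * Fin.revPerm) px =
      ∏ i, ∏ j, if i < j ∧ σ i < σ j then sgn (px (σ i) * px (σ j)) else 1 := by
    rw [superSign_eq_prod, ← Equiv.prod_comp Fin.revPerm, Finset.prod_comm,
      ← Equiv.prod_comp Fin.revPerm]
    refine Finset.prod_congr rfl fun i _ => Finset.prod_congr rfl fun j _ => ?_
    simp [mul_comm]
  rw [hrev, superSign_eq_prod, revSign, ← Finset.prod_mul_distrib]
  refine Finset.prod_congr rfl fun i _ => ?_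
  rw [← Finset.prod_mul_distrib]
  refine Finset.prod_congr rfl fun j _ => ?_
  by_cases hij : i < j
  · rcases lt_or_gt_of_ne (σ.injective.ne hij.ne) with h | h
    · simp [hij, h, h.not_gt]
    · simp [hij, h, h.not_gt]
  · simp [hij]

theorem Bform_eq_dotProduct (n : ℕ) (u v : Idx 1 (2 * n) → ℂ) :
    Bform n u v = u ⬝ᵥ (Bmat n *ᵥ v) := by
  simp only [Bform, dotProduct, Matrix.mulVec, Finset.mul_sum, mul_assoc]

theorem Bform_symPoly_mulVec_left {n k : ℕ} (X : Fin k → Matrix (Idx 1 (2 * n)) (Idx 1 (2 * n)) ℂ)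
    (px : Fin k → ZMod 2) (u v : Idx 1 (2 * n) → ℂ) :
    Bform n (symPoly X px *ᵥ u) v =
      ∑ σ : Equiv.Perm (Fin k), superSign σ px * Bform n (permProd σ X *ᵥ u) v := by
  simp only [Bform_eq_dotProduct, symPoly, Matrix.sum_mulVec, Matrix.smul_mulVec, sum_dotProduct,
    smul_dotProduct, smul_eq_mul]

theorem Bform_symPoly_mulVec_right {n k : ℕ}
    (X : Fin k → Matrix (Idx 1 (2 * n)) (Idx 1 (2 * n)) ℂ)
    (px : Fin k → ZMod 2) (u v : Idx 1 (2 * n) → ℂ) :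
    Bform n u (symPoly X px *ᵥ v) =
      ∑ σ : Equiv.Perm (Fin k), superSign σ px * Bform n u (permProd σ X *ᵥ v) := by
  simp only [Bform_eq_dotProduct, symPoly, Matrix.sum_mulVec, Matrix.smul_mulVec,
    Matrix.mulVec_sum, Matrix.mulVec_smul, dotProduct_sum, dotProduct_smul, smul_eq_mul]

/-- Moving a product of elements of `osp(1,2n)` across the form reverses it, up to sign. -/
theorem Bform_prod_ofFn_mulVec {n k : ℕ} (X : Fin k → Matrix (Idx 1 (2 * n)) (Idx 1 (2 * n)) ℂ)
    (px : Fin k → ZMod 2) (hX : ∀ i, ospMem (X i) (px i)) (u v : Idx 1 (2 * n) → ℂ)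
    (a b : ZMod 2) (hu : VHasParity u a) (hv : VHasParity v b) :
    Bform n ((List.ofFn X).prod *ᵥ u) v =
      (-1) ^ k * sgn ((∑ i, px i) * a) * revSign px *
        Bform n u ((List.ofFn fun i => X i.rev).prod *ᵥ v) := by
  induction k generalizing v b with
  | zero => simp [sgn, revSign]
  | succ k ih =>
    have htail : VHasParity ((List.ofFn fun i : Fin k => X i.succ).prod *ᵥ u)
        ((∑ i : Fin k, px i.succ) + a) :=
      (HasParity.prod_ofFn fun i => (hX i.succ).1).mulVec hu
    have h₀ := eq_neg_of_add_eq_zero_left ((hX 0).2 _ v _ b htail hv)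
    have h₁ := ih (fun i => X i.succ) (fun i => px i.succ) (fun i => hX i.succ) (X 0 *ᵥ v) _
      ((hX 0).1.mulVec hv)
    rw [List.ofFn_succ, List.prod_cons, ← Matrix.mulVec_mulVec, h₀, h₁, List.ofFn_succ',
      List.concat_eq_append, List.prod_append, List.prod_singleton, ← Matrix.mulVec_mulVec,
      revSign_succ, Fin.sum_univ_succ, add_mul, mul_add, sgn_add, sgn_add, pow_succ]
    simp only [Fin.rev_castSucc, Fin.rev_last]
    ring

/-- `𝒫_{2p+1}` of homogeneous elements of `osp(1,2n)` again lies in `osp(1,2n)`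
(as a homogeneous element of parity `|X₁|+…+|X_{2p+1}|`). -/
theorem symPoly_mem_osp (n p : ℕ) (hn : 1 ≤ n) (hp : 1 ≤ p)
    (X : Fin (2*p+1) → Matrix (Idx 1 (2*n)) (Idx 1 (2*n)) ℂ)
    (px : Fin (2*p+1) → ZMod 2) (hX : ∀ i, ospMem (X i) (px i)) :
    ospMem (symPoly X px) (∑ i, px i) := by
  refine ⟨.symPoly fun i => (hX i).1, fun u v a b hu hv => ?_⟩
  rw [Bform_symPoly_mulVec_left, Bform_symPoly_mulVec_right,
    ← Equiv.sum_comp (Equiv.mulRight (Fin.revPerm : Equiv.Perm (Fin (2 * p + 1))))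
      fun σ => superSign σ px * Bform n u (permProd σ X *ᵥ v),
    Finset.mul_sum, ← Finset.sum_add_distrib]
  refine Finset.sum_eq_zero fun σ _ => ?_
  have hσ := Bform_prod_ofFn_mulVec (fun i => X (σ i)) (fun i => px (σ i)) (fun i => hX (σ i))
    u v a b hu hv
  rw [Equiv.sum_comp σ px, ← superSign_mul_superSign_rev, Odd.neg_one_pow ⟨p, rfl⟩] at hσ
  simp only [Equiv.coe_mulRight, permProd, Equiv.Perm.mul_apply, Fin.revPerm_apply, hσ]
  linear_combination (-sgn ((∑ i, px i) * a) * superSign (σ * Fin.revPerm) px *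
    Bform n u ((List.ofFn fun i => X (σ i.rev)).prod *ᵥ v)) * superSign_mul_self σ px
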